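/- Let (L, h, (·,·)) be an extended affine Lie superalgebra over a field F of characteristic zero with root system R = R₀ ∪ R₁. If α ∈ R₀ satisfies (α,α) = 0, then (α,β) = 0 for all β ∈ R₀. Moreover, every nonzero α ∈ R₀ with (α,α) = 0 lies in the radical of R, i.e., (α,β) = 0 for all β ∈ R (equivalently, R₀ ∩ {α ∈ R : (α,α) = 0 and (α,β) ≠ 0 for some β ∈ R} = ∅). -/

import Mathlib

/-- A Lie superalgebra over `F`: a `ℤ/2`-graded vector space with a bilinear bracket
satisfying super skew-symmetry and the super Jacobi identity on homogeneous elements. -/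
structure LieSuperAlgebra (F : Type) [Field F] (L : Type) [AddCommGroup L] [Module F L] where
  bracket : L →ₗ[F] L →ₗ[F] L
  carrier : ZMod 2 → Submodule F L
  isCompl : IsCompl (carrier 0) (carrier 1)
  bracket_mem : ∀ i j : ZMod 2, ∀ x ∈ carrier i, ∀ y ∈ carrier j, bracket x y ∈ carrier (i + j)
  skew : ∀ i j : ZMod 2, ∀ x ∈ carrier i, ∀ y ∈ carrier j,
    bracket x y = -(((-1 : F) ^ (i.val * j.val)) • bracket y x)
  super_jacobi : ∀ i j : ZMod 2, ∀ x ∈ carrier i, ∀ y ∈ carrier j, ∀ z : L,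
    bracket (bracket x y) z
      = bracket x (bracket y z) - ((-1 : F) ^ (i.val * j.val)) • bracket y (bracket x z)

/-- A super-toral triple `(L, H, (·,·))`: a nonzero Lie superalgebra with a nontrivial
abelian subalgebra `H` of the even part, a nondegenerate invariant even supersymmetric
bilinear form whose restriction to `H` is nondegenerate, and a weight space decomposition
of `L` with respect to `H`. -/
structure SuperToral (F : Type) [Field F] (L : Type) [AddCommGroup L] [Module F L]
    extends LieSuperAlgebra F L where
  L_ne : ∃ x : L, x ≠ 0
  H : Submodule F L
  H_le : H ≤ carrier 0
  H_ne_bot : H ≠ ⊥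
  H_sub : ∀ x ∈ H, ∀ y ∈ H, bracket x y ∈ H
  form : L →ₗ[F] L →ₗ[F] F
  form_nondeg : ∀ x : L, (∀ y : L, form x y = 0) → x = 0
  form_inv : ∀ x y z : L, form (bracket x y) z = form x (bracket y z)
  form_even : ∀ x ∈ carrier 0, ∀ y ∈ carrier 1, form x y = 0
  form_super : ∀ i j : ZMod 2, ∀ x ∈ carrier i, ∀ y ∈ carrier j,
    form x y = ((-1 : F) ^ (i.val * j.val)) * form y x
  /-- The weight space attached to a linear functional on `H`. -/
  wt : Module.Dual F ↥H → Submodule F L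
  wt_def : ∀ (α : Module.Dual F ↥H) (x : L), x ∈ wt α ↔ ∀ t : ↥H, bracket ↑t x = α t • x
  /-- The weight spaces are independent … -/
  wt_indep : iSupIndep wt
  /-- … and they span `L`, i.e. `L = ⊕_α L^α`. -/
  wt_sup : (⨆ α : Module.Dual F ↥H, wt α) = ⊤
  form_H_nondeg : ∀ t : ↥H, (∀ s : ↥H, form ↑t ↑s = 0) → t = 0

/-- An extended affine Lie superalgebra: a super-toral triple such that (1) every nonzero
root space pair `(α, -α)` of fixed parity contains elements whose bracket is a nonzero
element of `H`, and (2) for every root `α` with `(α,α) ≠ 0` (expressed via a representative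
`t_α ∈ H` of `α` through the form), `ad x` is locally nilpotent for `x ∈ L^α`. -/
structure EALS (F : Type) [Field F] (L : Type) [AddCommGroup L] [Module F L]
    extends SuperToral F L where
  ax1 : ∀ i : ZMod 2, ∀ α : Module.Dual F ↥H, α ≠ 0 → carrier i ⊓ wt α ≠ ⊥ →
    ∃ x ∈ carrier i ⊓ wt α, ∃ y ∈ carrier i ⊓ wt (-α),
      bracket x y ∈ H ∧ bracket x y ≠ 0
  ax2 : ∀ α : Module.Dual F ↥H, wt α ≠ ⊥ →
    ∀ t : ↥H, (∀ s : ↥H, form ↑t ↑s = α s) → form ↑t ↑t ≠ 0 →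
    ∀ x ∈ wt α, ∀ y : L, ∃ n : ℕ, ((bracket x) ^ n) y = 0

/-- If `[e, f] = h`, `[h, e] = s e` and `[h, f] = -s f`, and `v` is an `h`-eigenvector on whose
orbit `e` and `f` are nilpotent, then twice its eigenvalue is an integer multiple of `s`. -/
theorem Module.End.exists_int_two_mul_eigenvalue_eq {F V : Type*} [Field F] [CharZero F]
    [AddCommGroup V] [Module F V] (e f h : Module.End F V) (s μ : F)
    (hef : e * f - f * e = h) (hhe : h * e - e * h = s • e) (hhf : h * f - f * h = -(s • f))
    (v : V) (hv : v ≠ 0) (hμ : h v = μ • v)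
    (he : ∃ n : ℕ, (e ^ n) v = 0) (hf : ∀ n : ℕ, ∃ k : ℕ, (f ^ k) ((e ^ n) v) = 0) :
    ∃ m : ℤ, 2 * μ = m * s := by
  have exists_last : ∀ (g : Module.End F V) (u : V), u ≠ 0 → (∃ n : ℕ, (g ^ n) u = 0) →
      ∃ n : ℕ, (g ^ n) u ≠ 0 ∧ g ((g ^ n) u) = 0 := by
    classical
    intro g u hu hg
    have h0 : Nat.find hg ≠ 0 := fun h0 => hu (by simpa [h0] using Nat.find_spec hg)
    obtain ⟨n, hn⟩ := Nat.exists_eq_succ_of_ne_zero h0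
    refine ⟨n, Nat.find_min hg (by omega), ?_⟩
    have := Nat.find_spec hg
    rwa [hn, Nat.succ_eq_add_one, pow_succ', Module.End.mul_apply] at this
  have hef' : ∀ u, e (f u) = f (e u) + h u := fun u => by
    rw [← hef]; simp
  have hhe' : ∀ u, h (e u) = e (h u) + s • e u := fun u => by
    have := LinearMap.congr_fun hhe u
    simp only [LinearMap.sub_apply, Module.End.mul_apply, LinearMap.smul_apply] at this
    rw [← this]; abel
  have hhf' : ∀ u, h (f u) = f (h u) - s • f u := fun u => by
    have := LinearMap.congr_fun hhf u
    simp only [LinearMap.sub_apply, Module.End.mul_apply, LinearMap.neg_apply,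
      LinearMap.smul_apply] at this
    rw [sub_eq_add_neg, ← this]; abel
  obtain ⟨n, hn, hn'⟩ := exists_last e v hv he
  obtain ⟨k, hk, hk'⟩ := exists_last f _ hn (hf n)
  have hw : h ((e ^ n) v) = (μ + n * s) • (e ^ n) v := by
    clear hn hn' hk hk'
    induction n with
    | zero => simpa using hμ
    | succ n ih =>
      rw [pow_succ', Module.End.mul_apply, hhe', ih, map_smul, ← add_smul]
      congr 1; push_cast; ring
  generalize (e ^ n) v = w at *
  generalize hc : μ + n * s = c at *
  have hh : ∀ j : ℕ, h ((f ^ j) w) = (c - j * s) • (f ^ j) w := by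
    intro j
    induction j with
    | zero => simpa using hw
    | succ j ih =>
      rw [pow_succ', Module.End.mul_apply, hhf', ih, map_smul, ← sub_smul]
      congr 1; push_cast; ring
  have hj : ∀ j : ℕ, e (f ((f ^ j) w)) = ((j + 1) * (c - j * s / 2)) • (f ^ j) w := by
    intro j
    induction j with
    | zero => simp [hef', hn', hw]
    | succ j ih =>
      rw [hef', hh, pow_succ', Module.End.mul_apply, ih, map_smul, ← add_smul]
      congr 1; push_cast; ring
  have h0 := hj k
  rw [hk', map_zero, eq_comm, smul_eq_zero_iff_left hk] at h0
  have hk1 : (k + 1 : F) ≠ 0 := by exact_mod_cast Nat.succ_ne_zero k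
  have h1 : c - k * s / 2 = 0 := (mul_eq_zero.mp h0).resolve_left hk1
  refine ⟨(k : ℤ) - 2 * n, ?_⟩
  push_cast
  linear_combination 2 * h1 + 2 * hc

section

variable {F : Type} [Field F] {L : Type} [AddCommGroup L] [Module F L]

namespace LieSuperAlgebra

theorem bracket_bracket_of_even (E : LieSuperAlgebra F L) {x y : L} (hx : x ∈ E.carrier 0)
    {i : ZMod 2} (hy : y ∈ E.carrier i) :
    E.bracket (E.bracket x y) = E.bracket x * E.bracket y - E.bracket y * E.bracket x := by
  ext z
  have := E.super_jacobi 0 i x hx y hy z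
  simpa using this

theorem bracket_comm_of_even (E : LieSuperAlgebra F L) {x y : L} (hx : x ∈ E.carrier 0)
    {i : ZMod 2} (hy : y ∈ E.carrier i) : E.bracket y x = -E.bracket x y := by
  have := E.skew i 0 y hy x hx
  simpa using this

end LieSuperAlgebra

namespace SuperToral

variable (E : SuperToral F L)

theorem form_comm_H (s t : E.H) : E.form s t = E.form t s := by
  have := E.form_super 0 0 s (E.H_le s.2) t (E.H_le t.2)
  simpa using this

theorem bracket_mem_wt {i : ZMod 2} {a b : Module.Dual F E.H} {x y : L}
    (hx : x ∈ E.carrier i) (hxa : x ∈ E.wt a) (hy : y ∈ E.wt b) :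
    E.bracket x y ∈ E.wt (a + b) := by
  rw [E.wt_def] at *
  intro t
  have h := LinearMap.congr_fun (E.bracket_bracket_of_even (E.H_le t.2) hx) y
  rw [hxa t] at h
  simp only [map_smul, LinearMap.smul_apply, LinearMap.sub_apply, Module.End.mul_apply, hy t] at h
  rw [LinearMap.add_apply, add_smul, h]
  abel

theorem pow_bracket_mem {i : ZMod 2} {a b : Module.Dual F E.H} {x v : L}
    (hx : x ∈ E.carrier 0 ⊓ E.wt a) (hv : v ∈ E.carrier i ⊓ E.wt b) (n : ℕ) :
    (E.bracket x ^ n) v ∈ E.carrier i ⊓ E.wt (b + n • a) := by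
  induction n with
  | zero => simpa using hv
  | succ n ih =>
    rw [pow_succ', Module.End.mul_apply]
    refine ⟨by simpa using E.bracket_mem 0 i x hx.1 _ ih.1, ?_⟩
    have := E.bracket_mem_wt hx.1 hx.2 ih.2
    rwa [show a + (b + n • a) = b + (n + 1) • a by rw [add_smul, one_smul]; abel] at this

theorem bracket_eq_smul {i : ZMod 2} {a : Module.Dual F E.H} {x y : L} (ta : E.H)
    (hta : ∀ s : E.H, E.form ta s = a s) (hy : y ∈ E.carrier i ⊓ E.wt (-a))
    (hxy : E.bracket x y ∈ E.H) : E.bracket x y = E.form x y • (ta : L) := by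
  have key := E.form_H_nondeg (⟨E.bracket x y, hxy⟩ - E.form x y • ta) (fun s => by
    have h1 : E.bracket y s = a s • y := by
      rw [E.bracket_comm_of_even (E.H_le s.2) hy.1, (E.wt_def _ _).1 hy.2 s]
      simp
    simp only [Submodule.coe_sub, Submodule.coe_smul, map_sub, map_smul, LinearMap.sub_apply,
      LinearMap.smul_apply, E.form_inv, h1, hta, smul_eq_mul]
    ring)
  simpa [sub_eq_zero] using congrArg Subtype.val key

theorem exists_carrier_inf_wt_ne_bot {b : Module.Dual F E.H} (hb : E.wt b ≠ ⊥) :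
    ∃ i : ZMod 2, E.carrier i ⊓ E.wt b ≠ ⊥ := by
  obtain ⟨x, hx, hx0⟩ := (Submodule.ne_bot_iff _).1 hb
  obtain ⟨y, hy, z, hz, rfl⟩ := Submodule.mem_sup.1
    (E.isCompl.sup_eq_top ▸ Submodule.mem_top : x ∈ E.carrier 0 ⊔ E.carrier 1)
  have hsplit : ∀ t : E.H, E.bracket t y - b t • y = 0 ∧ E.bracket t z - b t • z = 0 := by
    intro t
    have h := (E.wt_def _ _).1 hx t
    rw [map_add, smul_add] at h
    have h0 : E.bracket t y - b t • y ∈ E.carrier 0 :=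
      sub_mem (by simpa using E.bracket_mem 0 0 t (E.H_le t.2) y hy) (Submodule.smul_mem _ _ hy)
    have h1 : E.bracket t z - b t • z ∈ E.carrier 1 :=
      sub_mem (by simpa using E.bracket_mem 0 1 t (E.H_le t.2) z hz) (Submodule.smul_mem _ _ hz)
    have h2 : E.bracket t y - b t • y = -(E.bracket t z - b t • z) := by
      rw [eq_neg_iff_add_eq_zero, ← sub_eq_zero.2 h]; abel
    have h3 := Submodule.disjoint_def.1 E.isCompl.disjoint _ h0 (h2 ▸ neg_mem h1)
    exact ⟨h3, by rwa [h3, eq_comm, neg_eq_zero] at h2⟩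
  have hyw : y ∈ E.wt b := (E.wt_def _ _).2 fun t => sub_eq_zero.1 (hsplit t).1
  have hzw : z ∈ E.wt b := (E.wt_def _ _).2 fun t => sub_eq_zero.1 (hsplit t).2
  by_cases hy0 : y = 0
  · exact ⟨1, (Submodule.ne_bot_iff _).2 ⟨z, ⟨hz, hzw⟩, fun h => hx0 (by simp [hy0, h])⟩⟩
  · exact ⟨0, (Submodule.ne_bot_iff _).2 ⟨y, ⟨hy, hyw⟩, hy0⟩⟩

theorem exists_int_two_mul_form_eq [CharZero F] {a b : Module.Dual F E.H} (ta tb : E.H)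
    (hta : ∀ s : E.H, E.form ta s = a s) (htb : ∀ s : E.H, E.form tb s = b s) {x y v : L}
    (hx : x ∈ E.carrier 0 ⊓ E.wt a) (hy : y ∈ E.carrier 0 ⊓ E.wt (-a))
    (hxy : E.bracket x y ∈ E.H) (hxy0 : E.bracket x y ≠ 0) (hv : v ∈ E.wt b) (hv0 : v ≠ 0)
    (he : ∃ n : ℕ, (E.bracket x ^ n) v = 0)
    (hf : ∀ n : ℕ, ∃ k : ℕ, (E.bracket y ^ k) ((E.bracket x ^ n) v) = 0) :
    ∃ m : ℤ, 2 * E.form ta tb = m * E.form ta ta := by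
  have hb := E.bracket_eq_smul ta hta hy hxy
  have hp : E.form x y ≠ 0 := fun h => hxy0 (by rw [hb, h, zero_smul])
  have hwt : ∀ (d : Module.Dual F E.H) (u : L), u ∈ E.wt d →
      E.bracket (E.bracket x y) u = (E.form x y * d ta) • u := fun d u hu => by
    rw [hb, map_smul, LinearMap.smul_apply, (E.wt_def _ _).1 hu ta, smul_smul]
  obtain ⟨m, hm⟩ := Module.End.exists_int_two_mul_eigenvalue_eq (E.bracket x) (E.bracket y)
    (E.bracket (E.bracket x y)) (E.form x y * a ta) (E.form x y * b ta)
    (E.bracket_bracket_of_even hx.1 hy.1).symm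
    (by rw [← E.bracket_bracket_of_even (E.H_le hxy) hx.1, hwt a x hx.2, map_smul])
    (by rw [← E.bracket_bracket_of_even (E.H_le hxy) hy.1, hwt _ y hy.2, map_smul,
          LinearMap.neg_apply, mul_neg, neg_smul])
    v hv0 (hwt b v hv) he hf
  refine ⟨m, mul_left_cancel₀ hp ?_⟩
  rw [E.form_comm_H ta tb, hta, htb]
  linear_combination hm

end SuperToral

namespace EALS

variable [CharZero F] (E : EALS F L)

theorem exists_int_two_mul_form_eq_of_even {a b : Module.Dual F E.H} (ta tb : E.H)
    (hta : ∀ s : E.H, E.form ta s = a s) (htb : ∀ s : E.H, E.form tb s = b s)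
    (ha : E.carrier 0 ⊓ E.wt a ≠ ⊥) (hb : E.wt b ≠ ⊥) (haa : E.form ta ta ≠ 0) :
    ∃ m : ℤ, 2 * E.form ta tb = m * E.form ta ta := by
  have ha0 : a ≠ 0 := by
    rintro rfl
    exact haa (by simp [hta])
  obtain ⟨x, hx, y, hy, hxy, hxy0⟩ := E.ax1 0 a ha0 ha
  obtain ⟨v, hv, hv0⟩ := (Submodule.ne_bot_iff _).1 hb
  have hx0 : x ≠ 0 := by rintro rfl; simp at hxy0
  have hy0 : y ≠ 0 := by rintro rfl; simp at hxy0
  refine E.exists_int_two_mul_form_eq ta tb hta htb hx hy hxy hxy0 hv hv0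
    (E.ax2 a ((Submodule.ne_bot_iff _).2 ⟨x, hx.2, hx0⟩) ta hta haa x hx.2 v)
    (fun n => E.ax2 (-a) ((Submodule.ne_bot_iff _).2 ⟨y, hy.2, hy0⟩) (-ta) (fun s => ?_) ?_
      y hy.2 _)
  · simp [hta]
  · simpa using haa

theorem exists_int_two_mul_form_eq {i : ZMod 2} {a b : Module.Dual F E.H} (ta tb : E.H)
    (hta : ∀ s : E.H, E.form ta s = a s) (htb : ∀ s : E.H, E.form tb s = b s)
    (ha : E.carrier i ⊓ E.wt a ≠ ⊥) (hb : E.wt b ≠ ⊥) (haa : E.form ta ta ≠ 0) :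
    ∃ m : ℤ, 2 * E.form ta tb = m * E.form ta ta := by
  obtain rfl | rfl : i = 0 ∨ i = 1 := (by decide : ∀ j : ZMod 2, j = 0 ∨ j = 1) i
  · exact E.exists_int_two_mul_form_eq_of_even ta tb hta htb ha hb haa
  have ha0 : a ≠ 0 := by
    rintro rfl
    exact haa (by simp [hta])
  obtain ⟨x, hx, y, hy, hxy, hxy0⟩ := E.ax1 1 a ha0 ha
  have hx0 : x ≠ 0 := by rintro rfl; simp at hxy0
  have hb' := E.bracket_eq_smul ta hta hy hxy
  have hp : E.form x y ≠ 0 := fun h => hxy0 (by rw [hb', h, zero_smul])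
  have hxx0 : E.bracket x x ≠ 0 := by
    intro h
    have h1 := E.super_jacobi 1 1 x hx.1 x hx.1 y
    rw [h, E.bracket_comm_of_even (E.H_le hxy) hx.1, hb', map_smul, LinearMap.smul_apply,
      (E.wt_def _ _).1 hx.2 ta, ← hta, smul_smul] at h1
    have h2 : (2 * (E.form x y * E.form ta ta)) • x = 0 := by
      have hv : (1 : ZMod 2).val = 1 := rfl
      simp only [hv, map_zero, LinearMap.zero_apply, mul_one, pow_one, neg_smul, one_smul] at h1
      rw [two_mul, add_smul, ← neg_eq_zero, h1]
      abel
    rw [smul_eq_zero_iff_left hx0] at h2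
    simp [hp, haa] at h2
  have hmem : E.bracket x x ∈ E.carrier 0 ⊓ E.wt (a + a) :=
    ⟨E.bracket_mem 1 1 x hx.1 x hx.1, E.bracket_mem_wt hx.1 hx.2 hx.2⟩
  obtain ⟨m, hm⟩ := E.exists_int_two_mul_form_eq_of_even (ta + ta) tb
    (fun s => by simp [hta]) htb ((Submodule.ne_bot_iff _).2 ⟨_, hmem, hxx0⟩) hb (by
      have h4 : (4 : F) * E.form ta ta ≠ 0 := mul_ne_zero (by norm_num) haa
      simp only [Submodule.coe_add, map_add, LinearMap.add_apply]
      intro h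
      exact h4 (by linear_combination h))
  refine ⟨2 * m, ?_⟩
  simp only [Submodule.coe_add, map_add, LinearMap.add_apply] at hm
  push_cast
  linear_combination hm / 2

/-- If the isotropic even root `a` is not orthogonal to `b`, then the `a`-string through `b`
contains two roots that differ by `3a`. -/
theorem exists_string_of_isotropic {i : ZMod 2} {a b : Module.Dual F E.H} (ta tb : E.H)
    (hta : ∀ s : E.H, E.form ta s = a s) (htb : ∀ s : E.H, E.form tb s = b s)
    (ha0 : a ≠ 0) (ha : E.carrier 0 ⊓ E.wt a ≠ ⊥) (hb : E.carrier i ⊓ E.wt b ≠ ⊥)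
    (haa : E.form ta ta = 0) (hab : E.form ta tb ≠ 0) :
    ∃ k : ℤ, E.carrier i ⊓ E.wt (b + k • a) ≠ ⊥ ∧ E.carrier i ⊓ E.wt (b + (k + 3) • a) ≠ ⊥ := by
  obtain ⟨x, hx, y, hy, hxy, hxy0⟩ := E.ax1 0 a ha0 ha
  obtain ⟨v, hv, hv0⟩ := (Submodule.ne_bot_iff _).1 hb
  by_cases he : ∃ n : ℕ, (E.bracket x ^ n) v = 0
  · by_cases hf : ∀ n : ℕ, ∃ k : ℕ, (E.bracket y ^ k) ((E.bracket x ^ n) v) = 0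
    · obtain ⟨m, hm⟩ := E.toSuperToral.exists_int_two_mul_form_eq ta tb hta htb hx hy hxy hxy0
        hv.2 hv0 he hf
      simp [haa, hab] at hm
    · push Not at hf
      obtain ⟨n, hn⟩ := hf
      refine ⟨(n : ℤ) - 3, ?_, ?_⟩
      · have := E.pow_bracket_mem hy (E.pow_bracket_mem hx hv n) 3
        rw [show b + n • a + 3 • -a = b + ((n : ℤ) - 3) • a by module] at this
        exact (Submodule.ne_bot_iff _).2 ⟨_, this, hn 3⟩
      · have := E.pow_bracket_mem hx hv n
        rw [show b + n • a = b + ((n : ℤ) - 3 + 3) • a by module] at this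
        exact (Submodule.ne_bot_iff _).2 ⟨_, this, hn 0⟩
  · push Not at he
    refine ⟨0, by simpa using hb, ?_⟩
    have := E.pow_bracket_mem hx hv 3
    rw [show b + 3 • a = b + ((0 : ℤ) + 3) • a by module] at this
    exact (Submodule.ne_bot_iff _).2 ⟨_, this, he 3⟩

theorem form_eq_zero_of_isotropic {a b : Module.Dual F E.H} (ta tb : E.H)
    (hta : ∀ s : E.H, E.form ta s = a s) (htb : ∀ s : E.H, E.form tb s = b s)
    (ha0 : a ≠ 0) (ha : E.carrier 0 ⊓ E.wt a ≠ ⊥) (hb : E.wt b ≠ ⊥)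
    (haa : E.form ta ta = 0) : E.form ta tb = 0 := by
  by_contra hab
  obtain ⟨i, hbi⟩ := E.exists_carrier_inf_wt_ne_bot hb
  obtain ⟨k, hk, hk3⟩ := E.exists_string_of_isotropic ta tb hta htb ha0 ha hbi haa hab
  have key : ∀ j : ℤ, E.carrier i ⊓ E.wt (b + j • a) ≠ ⊥ →
      E.form tb tb + 2 * j * E.form ta tb = 0 ∨
      ∃ m : ℤ, 2 * E.form ta tb = m * (E.form tb tb + 2 * j * E.form ta tb) := by
    intro j hj
    have hself : E.form ((tb + j • ta : E.H) : L) ((tb + j • ta : E.H) : L)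
        = E.form tb tb + 2 * j * E.form ta tb := by
      simp only [Submodule.coe_add, ← Int.cast_smul_eq_zsmul F, Submodule.coe_smul, map_add,
        map_smul, LinearMap.add_apply, LinearMap.smul_apply, smul_eq_mul, haa,
        E.form_comm_H tb ta]
      ring
    have hmix : E.form ((tb + j • ta : E.H) : L) ta = E.form ta tb := by
      simp only [Submodule.coe_add, ← Int.cast_smul_eq_zsmul F, Submodule.coe_smul, map_add,
        map_smul, LinearMap.add_apply, LinearMap.smul_apply, smul_eq_mul, haa,
        E.form_comm_H tb ta]
      ring
    rw [← hself]
    by_cases h0 : E.form ((tb + j • ta : E.H) : L) ((tb + j • ta : E.H) : L) = 0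
    · exact Or.inl h0
    · refine Or.inr ?_
      rw [← hmix]
      refine E.exists_int_two_mul_form_eq (tb + j • ta) ta (fun s => ?_) hta hj
        (ne_bot_of_le_ne_bot ha inf_le_right) h0
      simp only [Submodule.coe_add, ← Int.cast_smul_eq_zsmul F, Submodule.coe_smul, map_add,
        map_smul, LinearMap.add_apply, LinearMap.smul_apply, hta, htb]
  have h1 := key k hk
  have h2 := key (k + 3) hk3
  push_cast at h2
  generalize E.form ta tb = c at *
  have h2c : 2 * c ≠ 0 := mul_ne_zero two_ne_zero hab
  have hu : E.form tb tb + 2 * (k + 3) * c = (E.form tb tb + 2 * k * c) + 3 * (2 * c) := by ring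
  rw [hu] at h2
  generalize E.form tb tb + 2 * k * c = u at *
  generalize 2 * c = d at *
  rcases h1 with rfl | ⟨m, hm⟩ <;> rcases h2 with h2 | ⟨m', hm'⟩
  · simp [h2c] at h2
  · have h3 : (m' * 3 : F) = 1 := mul_right_cancel₀ h2c (by linear_combination -hm')
    have : m' * 3 = 1 := by exact_mod_cast h3
    omega
  · have h3 : (m * (-3) : F) = 1 := mul_right_cancel₀ h2c (by linear_combination -(m * h2) - hm)
    have : m * (-3) = 1 := by exact_mod_cast h3
    omega
  · have h3 : (m' * (1 + 3 * m) : F) = m :=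
      mul_right_cancel₀ h2c (by linear_combination m' * hm - m * hm')
    have h4 : m' * (1 + 3 * m) = m := by exact_mod_cast h3
    have hm0 : m ≠ 0 := by
      rintro rfl
      exact h2c (by simpa using hm)
    have h5 : |1 + 3 * m| ≤ |m| :=
      Int.le_of_dvd (abs_pos.2 hm0) ((abs_dvd_abs _ _).2 ⟨m', by rw [mul_comm]; exact h4.symm⟩)
    rcases abs_cases (1 + 3 * m) with h | h <;> rcases abs_cases m with h' | h' <;> omega

end EALS

end


/-- an isotropic even root is orthogonal to all even roots, and, if nonzero,
lies in the radical of the root system (is orthogonal to all roots). -/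
theorem EALS_isotropic_even_root
    {F : Type} [Field F] [CharZero F] {L : Type} [AddCommGroup L] [Module F L]
    (E : EALS F L) (α : Module.Dual F ↥E.H)
    (hα : E.carrier 0 ⊓ E.wt α ≠ ⊥)
    (tα : ↥E.H) (hrep : ∀ s : ↥E.H, E.form ↑tα ↑s = α s)
    (haa : E.form ↑tα ↑tα = 0) :
    (∀ β : Module.Dual F ↥E.H, E.carrier 0 ⊓ E.wt β ≠ ⊥ →
        ∀ tβ : ↥E.H, (∀ s : ↥E.H, E.form ↑tβ ↑s = β s) → E.form ↑tα ↑tβ = 0) ∧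
    (α ≠ 0 → ∀ β : Module.Dual F ↥E.H, E.wt β ≠ ⊥ →
        ∀ tβ : ↥E.H, (∀ s : ↥E.H, E.form ↑tβ ↑s = β s) → E.form ↑tα ↑tβ = 0) := by
  have main : α ≠ 0 → ∀ β : Module.Dual F ↥E.H, E.wt β ≠ ⊥ →
      ∀ tβ : ↥E.H, (∀ s : ↥E.H, E.form ↑tβ ↑s = β s) → E.form ↑tα ↑tβ = 0 :=
    fun h0 β hβ tβ hrepβ => E.form_eq_zero_of_isotropic tα tβ hrep hrepβ h0 hα hβ haa
  refine ⟨fun β hβ tβ hrepβ => ?_, main⟩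
  by_cases h0 : α = 0
  · rw [hrep, h0, LinearMap.zero_apply]
  · exact main h0 β (ne_bot_of_le_ne_bot hβ inf_le_right) tβ hrepβ
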